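/- arXiv:1503.08702 — 2 statements merged into one kernel-verified Lean document; each statement's English description precedes it below -/
import Mathlib

section
/- L^p bound for centred linear statistics of exchangeable random vectors. There exists an absolute constant C > 0 with the following property. Let (Y_i)_{i=1}^N be an exchangeable random vector of real-valued random variables, i.e. for every permutation σ of {1,…,N} the vector (Y_{σ(i)})_i has the same distribution as (Y_i)_i. Let a_1, …, a_N ∈ ℝ be deterministic with Σ_{i=1}^N a_i = 0 and Σ_{i=1}^N a_i² ≤ 1. Then for all real p ≥ 2: ‖ Σ_{i=1}^N a_i·Y_i ‖_p ≤ C·(p²/log p)·‖Y_1‖_p, where ‖X‖_p := (E|X|^p)^{1/p}. -/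
open MeasureTheory

noncomputable section

/-- The map `x ↦ x |x|^(p-2)` has increments controlled by its derivative at the endpoints. -/
theorem sub_mul_signed_rpow_sub_le {p : ℝ} (hp : 2 ≤ p) (x y : ℝ) :
    (x - y) * (x * |x| ^ (p - 2) - y * |y| ^ (p - 2)) ≤
      (p - 1) * ((x - y) ^ 2 * (|x| ^ (p - 2) + |y| ^ (p - 2))) := by
  have key : ∀ x y : ℝ, 0 < x → |y| ≤ x →
      (x - y) * (x * |x| ^ (p - 2) - y * |y| ^ (p - 2)) ≤
        (p - 1) * ((x - y) ^ 2 * (|x| ^ (p - 2) + |y| ^ (p - 2))) := by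
    intro x y hx hy
    have hxy : y ≤ x := (le_abs_self y).trans hy
    have hX : 0 ≤ |x| ^ (p - 2) := by positivity
    have hY : 0 ≤ |y| ^ (p - 2) := by positivity
    have hYX : |y| ^ (p - 2) ≤ |x| ^ (p - 2) :=
      Real.rpow_le_rpow (abs_nonneg _) (by rwa [abs_of_pos hx]) (by linarith)
    suffices h : x * |x| ^ (p - 2) - y * |y| ^ (p - 2) ≤
        (p - 1) * ((x - y) * |x| ^ (p - 2)) by
      have h1 := mul_le_mul_of_nonneg_left h (sub_nonneg.2 hxy)
      have h2 : 0 ≤ (p - 1) * ((x - y) ^ 2 * |y| ^ (p - 2)) :=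
        mul_nonneg (by linarith) (by positivity)
      linarith
    rcases le_or_gt y 0 with hy0 | hy0
    · have h1 : -y * |y| ^ (p - 2) ≤ -y * |x| ^ (p - 2) :=
        mul_le_mul_of_nonneg_left hYX (by linarith)
      have h2 : 0 ≤ (p - 2) * ((x - y) * |x| ^ (p - 2)) :=
        mul_nonneg (by linarith) (mul_nonneg (by linarith) hX)
      linarith
    · rw [abs_of_pos hx, abs_of_pos hy0]
      have hb := one_add_mul_self_le_rpow_one_add (s := y / x - 1) (p := p - 1)
        (by linarith [div_pos hy0 hx]) (by linarith)
      rw [add_sub_cancel, Real.div_rpow hy0.le hx.le, le_div_iff₀ (by positivity)] at hb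
      have e : ∀ z : ℝ, 0 < z → z ^ (p - 1) = z * z ^ (p - 2) := fun z hz => by
        rw [show p - 1 = 1 + (p - 2) by ring, Real.rpow_add hz, Real.rpow_one]
      rw [e x hx, e y hy0] at hb
      have : (1 + (p - 1) * (y / x - 1)) * (x * x ^ (p - 2)) =
          x * x ^ (p - 2) - (p - 1) * ((x - y) * x ^ (p - 2)) := by
        field_simp
        ring
      linarith
  have key' : ∀ x y : ℝ, |y| ≤ |x| →
      (x - y) * (x * |x| ^ (p - 2) - y * |y| ^ (p - 2)) ≤
        (p - 1) * ((x - y) ^ 2 * (|x| ^ (p - 2) + |y| ^ (p - 2))) := by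
    intro x y hxy
    rcases lt_trichotomy x 0 with hx | rfl | hx
    · have := key (-x) (-y) (by linarith) (by rwa [abs_neg, ← abs_of_neg hx])
      rw [abs_neg, abs_neg] at this
      linarith
    · have : y = 0 := by simpa using hxy
      simp [this]
    · exact key x y hx (by rwa [abs_of_pos hx] at hxy)
  rcases le_total |y| |x| with h | h
  · exact key' x y h
  · linarith [key' y x h]

theorem sum_mul_sub_sum_mul_swap {ι : Type*} [Fintype ι] [DecidableEq ι]
    (a y : ι → ℝ) (σ : Equiv.Perm ι) (i j : ι) :
    ∑ k, a k * y (σ k) - ∑ k, a k * y ((σ * Equiv.swap i j) k) =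
      (a i - a j) * (y (σ i) - y (σ j)) := by
  rcases eq_or_ne i j with rfl | hij
  · simp
  rw [← Finset.sum_sub_distrib, ← Finset.sum_subset (Finset.subset_univ {i, j}),
    Finset.sum_pair hij]
  · simp only [Equiv.Perm.mul_apply, Equiv.swap_apply_left, Equiv.swap_apply_right]
    ring
  · intro k _ hk
    simp only [Finset.mem_insert, Finset.mem_singleton, not_or] at hk
    simp [Equiv.swap_apply_of_ne_of_ne hk.1 hk.2]

theorem sum_sum_sub_mul_sub {ι : Type*} [Fintype ι] (a z : ι → ℝ) (ha : ∑ i, a i = 0) :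
    ∑ i, ∑ j, (a i - a j) * (z i - z j) = 2 * Fintype.card ι * ∑ i, a i * z i := by
  simp only [sub_mul, mul_sub, Finset.sum_sub_distrib, ← Finset.mul_sum, ← Finset.sum_mul, ha,
    Finset.sum_const, Finset.card_univ, nsmul_eq_mul, mul_left_comm _ (Fintype.card ι : ℝ)]
  ring

theorem sum_sum_sq_sub_mul_sq_sub_le {ι : Type*} [Fintype ι] (a z : ι → ℝ) :
    ∑ i, ∑ j, (a i - a j) ^ 2 * (z i - z j) ^ 2 ≤
      8 * (Fintype.card ι * ∑ i, a i ^ 2 * z i ^ 2 + (∑ i, a i ^ 2) * ∑ i, z i ^ 2) := by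
  have h : ∀ i j, (a i - a j) ^ 2 * (z i - z j) ^ 2 ≤
      4 * (a i ^ 2 + a j ^ 2) * (z i ^ 2 + z j ^ 2) := fun i j => by
    have h1 : (a i - a j) ^ 2 ≤ 2 * (a i ^ 2 + a j ^ 2) := by nlinarith [sq_nonneg (a i + a j)]
    have h2 : (z i - z j) ^ 2 ≤ 2 * (z i ^ 2 + z j ^ 2) := by nlinarith [sq_nonneg (z i + z j)]
    calc _ ≤ 2 * (a i ^ 2 + a j ^ 2) * (2 * (z i ^ 2 + z j ^ 2)) := by gcongr
      _ = _ := by ring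
  refine (Finset.sum_le_sum fun i _ => Finset.sum_le_sum fun j _ => h i j).trans_eq ?_
  simp only [mul_assoc, ← Finset.mul_sum, add_mul, mul_add, Finset.sum_add_distrib,
    ← Finset.sum_mul, Finset.sum_const, Finset.card_univ, nsmul_eq_mul,
    mul_left_comm _ (Fintype.card ι : ℝ)]
  ring

/-- Moment form of the exchangeable pair identity for a random transposition. -/
theorem sum_perm_abs_rpow_le {ι : Type*} [Fintype ι] [DecidableEq ι]
    {p : ℝ} (hp : 2 ≤ p) (a y : ι → ℝ) (ha : ∑ i, a i = 0) :
    2 * Fintype.card ι * ∑ σ : Equiv.Perm ι, |∑ k, a k * y (σ k)| ^ p ≤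
      (p - 1) * ∑ σ : Equiv.Perm ι,
        (∑ i, ∑ j, (a i - a j) ^ 2 * (y (σ i) - y (σ j)) ^ 2) *
          |∑ k, a k * y (σ k)| ^ (p - 2) := by
  set W : Equiv.Perm ι → ℝ := fun σ => ∑ k, a k * y (σ k) with hW
  set f : ℝ → ℝ := fun x => x * |x| ^ (p - 2) with hf
  have hdiff : ∀ σ i j, W σ - W (σ * Equiv.swap i j) = (a i - a j) * (y (σ i) - y (σ j)) :=
    fun σ i j => sum_mul_sub_sum_mul_swap a y σ i j
  have hxf : ∀ x, |x| ^ p = x * f x := fun x => by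
    rcases eq_or_ne x 0 with rfl | hx
    · simp [hf, Real.zero_rpow (by linarith : p ≠ 0)]
    · have : |x| ^ p = |x| ^ (2 : ℝ) * |x| ^ (p - 2) := by
        rw [← Real.rpow_add (abs_pos.2 hx)]
        congr 1
        ring
      rw [this, Real.rpow_two, sq_abs]
      ring
  have hinv : ∀ (g : Equiv.Perm ι → Equiv.Perm ι → ℝ) (i j : ι),
      ∑ σ, g (σ * Equiv.swap i j) σ = ∑ σ, g σ (σ * Equiv.swap i j) := fun g i j => by
    rw [← Equiv.sum_comp (Equiv.mulRight (Equiv.swap i j))]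
    simp [mul_assoc]
  have hpair : ∀ i j, ∑ σ, (W σ - W (σ * Equiv.swap i j)) * f (W σ) ≤
      (p - 1) * ∑ σ, (W σ - W (σ * Equiv.swap i j)) ^ 2 * |W σ| ^ (p - 2) := fun i j => by
    have h1 := Finset.sum_le_sum fun σ (_ : σ ∈ Finset.univ) =>
      sub_mul_signed_rpow_sub_le hp (W σ) (W (σ * Equiv.swap i j))
    have h2 := hinv (fun σ τ => (W τ - W σ) * f (W σ)) i j
    have h3 := hinv (fun σ τ => (W τ - W σ) ^ 2 * |W σ| ^ (p - 2)) i j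
    have h4 : ∀ σ τ, (W τ - W σ) * f (W σ) = -((W σ - W τ) * f (W σ)) := fun _ _ => by ring
    have h5 : ∀ σ τ, (W τ - W σ) ^ 2 = (W σ - W τ) ^ 2 := fun _ _ => by ring
    simp only [mul_add, mul_sub, Finset.sum_add_distrib, Finset.sum_sub_distrib,
      ← Finset.mul_sum] at h1
    simp only [h4 _ (_ * _), Finset.sum_neg_distrib] at h2
    simp only [h5 _ (_ * _)] at h3
    simp only [hf] at h2 ⊢
    rw [h3] at h1
    linarith
  calc 2 * Fintype.card ι * ∑ σ, |W σ| ^ p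
      = ∑ σ, ∑ i, ∑ j, (W σ - W (σ * Equiv.swap i j)) * f (W σ) := by
        rw [Finset.mul_sum]
        refine Finset.sum_congr rfl fun σ _ => ?_
        simp only [hdiff, ← Finset.sum_mul]
        rw [sum_sum_sub_mul_sub a (fun i => y (σ i)) ha, hxf]
        ring
    _ = ∑ i, ∑ j, ∑ σ, (W σ - W (σ * Equiv.swap i j)) * f (W σ) := by
        rw [Finset.sum_comm]
        exact Finset.sum_congr rfl fun i _ => Finset.sum_comm
    _ ≤ ∑ i, ∑ j, (p - 1) * ∑ σ, (W σ - W (σ * Equiv.swap i j)) ^ 2 * |W σ| ^ (p - 2) :=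
        Finset.sum_le_sum fun i _ => Finset.sum_le_sum fun j _ => hpair i j
    _ = (p - 1) * ∑ σ, ∑ i, ∑ j,
          (W σ - W (σ * Equiv.swap i j)) ^ 2 * |W σ| ^ (p - 2) := by
        simp only [← Finset.mul_sum]
        congr 1
        rw [Finset.sum_comm (s := (Finset.univ : Finset (Equiv.Perm ι)))]
        exact Finset.sum_congr rfl fun i _ => Finset.sum_comm
    _ = _ := by
        simp only [hdiff, mul_pow, Finset.sum_mul]
        rfl

/-- Permutation averages of `|∑ a_k y_{σ(k)}|^p` are at most `(8 (p - 1))^(p/2)` times averages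
of `|y_i|^p`. -/
theorem exists_weights_sum_perm_abs_rpow_le {ι : Type*} [Fintype ι] [DecidableEq ι]
    [Nonempty ι] (a : ι → ℝ) (ha : ∑ i, a i = 0)
    (ha2 : ∑ i, a i ^ 2 ≤ 1) :
    ∃ u : ι → ℝ, (∀ i, 0 ≤ u i) ∧ ∑ i, u i = 1 ∧ ∀ p : ℝ, 2 ≤ p → ∀ y : ι → ℝ,
      ∑ σ : Equiv.Perm ι, |∑ k, a k * y (σ k)| ^ p ≤
        ∑ σ : Equiv.Perm ι, (8 * (p - 1)) ^ (p / 2) * ∑ i, u i * |y (σ i)| ^ p := by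
  set A := ∑ i, a i ^ 2 with hA
  have hn : (0 : ℝ) < Fintype.card ι := by exact_mod_cast Fintype.card_pos
  set n : ℝ := (Fintype.card ι : ℝ) with hndef
  set u : ι → ℝ := fun i => (a i ^ 2 + (2 - A) / n) / 2 with hu
  have hu0 : ∀ i, 0 ≤ u i := fun i => by
    have : 0 ≤ (2 - A) / n := div_nonneg (by linarith) hn.le
    simp only [hu]
    positivity
  have hu1 : ∑ i, u i = 1 := by
    simp only [hu, ← Finset.sum_div, Finset.sum_add_distrib, Finset.sum_const, Finset.card_univ,
      nsmul_eq_mul, ← hA, ← hndef]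
    field_simp
    ring
  refine ⟨u, hu0, hu1, fun p hp y => ?_⟩
  set c := 8 * (p - 1) with hc
  have hc0 : 0 ≤ c := by linarith
  set W : Equiv.Perm ι → ℝ := fun σ => ∑ k, a k * y (σ k)
  set Q : Equiv.Perm ι → ℝ := fun σ => ∑ i, u i * y (σ i) ^ 2 with hQ
  have hQ0 : ∀ σ, 0 ≤ Q σ := fun σ =>
    Finset.sum_nonneg fun i _ => mul_nonneg (hu0 i) (sq_nonneg _)
  have hV : ∀ σ : Equiv.Perm ι,
      ∑ i, ∑ j, (a i - a j) ^ 2 * (y (σ i) - y (σ j)) ^ 2 ≤ 16 * n * Q σ := fun σ => by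
    refine (sum_sum_sq_sub_mul_sq_sub_le a fun i => y (σ i)).trans ?_
    have hS : 0 ≤ ∑ i, y (σ i) ^ 2 := Finset.sum_nonneg fun i _ => sq_nonneg _
    have : 16 * n * Q σ =
        8 * (n * ∑ i, a i ^ 2 * y (σ i) ^ 2 + (2 - A) * ∑ i, y (σ i) ^ 2) := by
      simp only [hQ, hu, Finset.mul_sum, ← Finset.sum_add_distrib]
      refine Finset.sum_congr rfl fun i _ => ?_
      field_simp
      ring
    rw [this]
    have : A * ∑ i, y (σ i) ^ 2 ≤ (2 - A) * ∑ i, y (σ i) ^ 2 := by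
      gcongr
      linarith
    linarith
  have h1 : ∑ σ, |W σ| ^ p ≤ ∑ σ, c * Q σ * |W σ| ^ (p - 2) := by
    have h := sum_perm_abs_rpow_le hp a y ha
    have h' : (p - 1) * ∑ σ : Equiv.Perm ι,
        (∑ i, ∑ j, (a i - a j) ^ 2 * (y (σ i) - y (σ j)) ^ 2) * |W σ| ^ (p - 2) ≤
        (p - 1) * ∑ σ : Equiv.Perm ι, 16 * n * Q σ * |W σ| ^ (p - 2) := by
      refine mul_le_mul_of_nonneg_left (Finset.sum_le_sum fun σ _ => ?_) (by linarith)
      exact mul_le_mul_of_nonneg_right (hV σ) (by positivity)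
    have h'' : (p - 1) * ∑ σ : Equiv.Perm ι, 16 * n * Q σ * |W σ| ^ (p - 2) =
        2 * n * ∑ σ, c * Q σ * |W σ| ^ (p - 2) := by
      simp only [Finset.mul_sum, hc]
      refine Finset.sum_congr rfl fun σ _ => ?_
      ring
    exact le_of_mul_le_mul_left ((h.trans h').trans_eq h'') (by positivity)
  have hyoung : ∀ σ, c * Q σ * |W σ| ^ (p - 2) ≤
      2 / p * (c * Q σ) ^ (p / 2) + (1 - 2 / p) * |W σ| ^ p := fun σ => by
    have hcQ : 0 ≤ c * Q σ := mul_nonneg hc0 (hQ0 σ)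
    have h := Real.geom_mean_le_arith_mean2_weighted (w₁ := 2 / p) (w₂ := 1 - 2 / p)
      (p₁ := (c * Q σ) ^ (p / 2)) (p₂ := |W σ| ^ p) (by positivity)
      (by rw [sub_nonneg, div_le_one (by linarith)]; exact hp)
      (by positivity) (by positivity) (by ring)
    rw [← Real.rpow_mul hcQ, ← Real.rpow_mul (abs_nonneg _)] at h
    have hp0 : p ≠ 0 := by linarith
    rw [show p / 2 * (2 / p) = 1 by field_simp, Real.rpow_one,
      show p * (1 - 2 / p) = p - 2 by field_simp] at h
    exact h
  have h2 : ∑ σ, |W σ| ^ p ≤ ∑ σ, (c * Q σ) ^ (p / 2) := by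
    have h := h1.trans (Finset.sum_le_sum fun σ _ => hyoung σ)
    rw [Finset.sum_add_distrib, ← Finset.mul_sum, ← Finset.mul_sum] at h
    have h' : 2 / p * ∑ σ, |W σ| ^ p ≤ 2 / p * ∑ σ, (c * Q σ) ^ (p / 2) := by linarith
    exact le_of_mul_le_mul_left h' (by positivity)
  refine h2.trans (Finset.sum_le_sum fun σ _ => ?_)
  rw [Real.mul_rpow hc0 (hQ0 σ)]
  refine mul_le_mul_of_nonneg_left ?_ (by positivity)
  refine (Real.rpow_arith_mean_le_arith_mean_rpow Finset.univ u (fun i => y (σ i) ^ 2)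
    (fun i _ => hu0 i) hu1 (fun i _ => sq_nonneg _) (by linarith : 1 ≤ p / 2)).trans_eq ?_
  refine Finset.sum_congr rfl fun i _ => ?_
  rw [← sq_abs, ← Real.rpow_two, ← Real.rpow_mul (abs_nonneg _)]
  congr 2
  ring

theorem lintegral_comp_perm_eq {ι Ω : Type*} [MeasurableSpace Ω] {μ : Measure Ω} {Y : ι → Ω → ℝ}
    (hY : ∀ i, Measurable (Y i))
    (hex : ∀ σ : Equiv.Perm ι,
      Measure.map (fun ω => fun i => Y (σ i) ω) μ = Measure.map (fun ω => fun i => Y i ω) μ)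
    {F : (ι → ℝ) → ENNReal} (hF : Measurable F) (σ : Equiv.Perm ι) :
    ∫⁻ ω, F (fun i => Y (σ i) ω) ∂μ = ∫⁻ ω, F (fun i => Y i ω) ∂μ := by
  rw [← lintegral_map hF (measurable_pi_lambda _ fun i => hY (σ i)), hex σ,
    lintegral_map hF (measurable_pi_lambda _ hY)]

/-- Linear statistics of exchangeable vectors with centred coefficients of Euclidean norm at
most one satisfy a Khintchine type bound. -/
theorem eLpNorm_linear_statistic_le {N : ℕ} (i₀ : Fin N) {Ω : Type*} [MeasurableSpace Ω]
    {μ : Measure Ω} {Y : Fin N → Ω → ℝ} (hY : ∀ i, Measurable (Y i))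
    (hex : ∀ σ : Equiv.Perm (Fin N),
      Measure.map (fun ω => fun i => Y (σ i) ω) μ = Measure.map (fun ω => fun i => Y i ω) μ)
    {a : Fin N → ℝ} (ha : ∑ i, a i = 0) (ha2 : ∑ i, a i ^ 2 ≤ 1) {p : ℝ} (hp : 2 ≤ p) :
    eLpNorm (fun ω => ∑ i, a i * Y i ω) (ENNReal.ofReal p) μ ≤
      ENNReal.ofReal ((8 * (p - 1)) ^ (1 / 2 : ℝ)) * eLpNorm (Y i₀) (ENNReal.ofReal p) μ := by
  have : Nonempty (Fin N) := ⟨i₀⟩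
  have hp0 : 0 < p := by linarith
  obtain ⟨u, hu0, hu1, hu⟩ := exists_weights_sum_perm_abs_rpow_le a ha ha2
  have hnorm : ∀ g : Ω → ℝ, eLpNorm g (ENNReal.ofReal p) μ =
      (∫⁻ ω, ENNReal.ofReal (|g ω| ^ p) ∂μ) ^ (1 / p) := fun g => by
    rw [eLpNorm_eq_lintegral_rpow_enorm_toReal (by simpa using hp0) ENNReal.ofReal_ne_top,
      ENNReal.toReal_ofReal hp0.le]
    congr 2 with ω
    rw [← ENNReal.ofReal_rpow_of_nonneg (abs_nonneg _) hp0.le, ← Real.norm_eq_abs,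
      ofReal_norm]
  set c := 8 * (p - 1) with hc
  have hc0 : 0 ≤ c := by linarith
  have hY1 : ∀ i, ∫⁻ ω, ENNReal.ofReal (|Y i ω| ^ p) ∂μ =
      ∫⁻ ω, ENNReal.ofReal (|Y i₀ ω| ^ p) ∂μ := fun i => by
    have := lintegral_comp_perm_eq (F := fun v => ENNReal.ofReal (|v i₀| ^ p)) hY hex
      (by fun_prop) (Equiv.swap i₀ i)
    simpa using this
  have hW : ∀ σ : Equiv.Perm (Fin N), ∫⁻ ω, ENNReal.ofReal (|∑ k, a k * Y (σ k) ω| ^ p) ∂μ =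
      ∫⁻ ω, ENNReal.ofReal (|∑ k, a k * Y k ω| ^ p) ∂μ :=
    lintegral_comp_perm_eq (F := fun v => ENNReal.ofReal (|∑ k, a k * v k| ^ p)) hY hex
      (by fun_prop)
  have hR : ∀ σ : Equiv.Perm (Fin N),
      ∫⁻ ω, ENNReal.ofReal (c ^ (p / 2) * ∑ i, u i * |Y (σ i) ω| ^ p) ∂μ =
        ENNReal.ofReal (c ^ (p / 2)) * ∫⁻ ω, ENNReal.ofReal (|Y i₀ ω| ^ p) ∂μ := fun σ => by
    have hpt : ∀ ω, ENNReal.ofReal (c ^ (p / 2) * ∑ i, u i * |Y (σ i) ω| ^ p) =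
        ENNReal.ofReal (c ^ (p / 2)) *
          ∑ i, ENNReal.ofReal (u i) * ENNReal.ofReal (|Y (σ i) ω| ^ p) := fun ω => by
      rw [ENNReal.ofReal_mul (by positivity), ENNReal.ofReal_sum_of_nonneg
        fun i _ => mul_nonneg (hu0 i) (by positivity)]
      simp only [ENNReal.ofReal_mul (hu0 _)]
    simp only [hpt]
    rw [lintegral_const_mul _ (by fun_prop), lintegral_finsetSum _ (by fun_prop)]
    have : ∀ i, ∫⁻ ω, ENNReal.ofReal (u i) * ENNReal.ofReal (|Y (σ i) ω| ^ p) ∂μ =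
        ENNReal.ofReal (u i) * ∫⁻ ω, ENNReal.ofReal (|Y i₀ ω| ^ p) ∂μ := fun i => by
      rw [lintegral_const_mul _ (by fun_prop), hY1]
    simp only [this]
    rw [← Finset.sum_mul, ← ENNReal.ofReal_sum_of_nonneg fun i _ => hu0 i, hu1,
      ENNReal.ofReal_one, one_mul]
  have hmain : ∫⁻ ω, ENNReal.ofReal (|∑ k, a k * Y k ω| ^ p) ∂μ ≤
      ENNReal.ofReal (c ^ (p / 2)) * ∫⁻ ω, ENNReal.ofReal (|Y i₀ ω| ^ p) ∂μ := by
    have h : ∫⁻ ω, ∑ σ : Equiv.Perm (Fin N), ENNReal.ofReal (|∑ k, a k * Y (σ k) ω| ^ p) ∂μ ≤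
        ∫⁻ ω, ∑ σ : Equiv.Perm (Fin N),
          ENNReal.ofReal (c ^ (p / 2) * ∑ i, u i * |Y (σ i) ω| ^ p) ∂μ := by
      refine lintegral_mono fun ω => ?_
      rw [← ENNReal.ofReal_sum_of_nonneg fun σ _ => by positivity,
        ← ENNReal.ofReal_sum_of_nonneg fun σ _ => mul_nonneg (by positivity) <|
          Finset.sum_nonneg fun i _ => mul_nonneg (hu0 i) (by positivity)]
      exact ENNReal.ofReal_le_ofReal (hu p hp fun i => Y i ω)
    rw [lintegral_finsetSum _ (by fun_prop), lintegral_finsetSum _ (by fun_prop)] at h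
    simp only [hW, hR, Finset.sum_const, nsmul_eq_mul] at h
    refine (ENNReal.mul_le_mul_iff_right ?_ (ENNReal.natCast_ne_top _)).1 h
    simp
  rw [hnorm, hnorm]
  refine (ENNReal.rpow_le_rpow hmain (by positivity)).trans_eq ?_
  rw [ENNReal.mul_rpow_of_nonneg _ _ (by positivity),
    ENNReal.ofReal_rpow_of_nonneg (by positivity) (by positivity), ← Real.rpow_mul hc0]
  congr 3
  field_simp

/-- **L^p bound for centred linear statistics of exchangeable random vectors.**
If `(Y_i)` is exchangeable and `Σ a_i = 0`, `Σ a_i² ≤ 1`, then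
`‖Σ a_i Y_i‖_p ≤ C (p²/log p) ‖Y_1‖_p`. -/
theorem exchangeable_linear_statistics_Lp :
    ∃ C : ℝ, 0 < C ∧
      ∀ (N : ℕ) (hN : 0 < N) (Ω : Type) [MeasurableSpace Ω] (μ : Measure Ω)
        [IsProbabilityMeasure μ] (Y : Fin N → Ω → ℝ),
        (∀ i, Measurable (Y i)) →
        (∀ σ : Equiv.Perm (Fin N),
          Measure.map (fun ω => fun i => Y (σ i) ω) μ =
            Measure.map (fun ω => fun i => Y i ω) μ) →
        ∀ a : Fin N → ℝ, (∑ i, a i) = 0 → (∑ i, a i ^ 2) ≤ 1 →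
          ∀ p : ℝ, 2 ≤ p →
            eLpNorm (fun ω => ∑ i, a i * Y i ω) (ENNReal.ofReal p) μ ≤
              ENNReal.ofReal (C * (p ^ 2 / Real.log p)) *
                eLpNorm (Y ⟨0, hN⟩) (ENNReal.ofReal p) μ := by
  refine ⟨3, by norm_num, fun N hN Ω _ μ _ Y hY hex a ha ha2 p hp => ?_⟩
  refine (eLpNorm_linear_statistic_le ⟨0, hN⟩ hY hex ha ha2 hp).trans ?_
  gcongr
  have hlog : 0 < Real.log p := Real.log_pos (by linarith)
  have hlog' : Real.log p ≤ p := (Real.log_le_sub_one_of_pos (by linarith)).trans (by linarith)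
  rw [← Real.sqrt_eq_rpow]
  calc √(8 * (p - 1)) ≤ 3 * p := Real.sqrt_le_iff.2 ⟨by linarith, by nlinarith⟩
    _ ≤ 3 * (p ^ 2 / Real.log p) := by
      gcongr
      rw [le_div_iff₀ hlog]
      nlinarith

end
end

section
/- L^p bound for centred quadratic forms of exchangeable random matrices. There exists an absolute constant C > 0 with the following property. Let (Y_{ij})_{i,j=1}^N be an exchangeable random matrix of real-valued random variables, i.e. for every permutation σ of {1,…,N} the array (Y_{σ(i)σ(j)})_{i,j} has the same distribution as (Y_{ij})_{i,j}. Let a_1, …, a_N ∈ ℝ be deterministic with Σ_{i=1}^N a_i = 0 and Σ_{i=1}^N a_i² ≤ 1. Then for all real p ≥ 2: ‖ Σ_{i,j=1}^N a_i·a_j·Y_{ij} ‖_p ≤ ‖Y_{11}‖_p + C·(p²/log p)²·‖Y_{12}‖_p, where ‖X‖_p := (E|X|^p)^{1/p}. -/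
open MeasureTheory
noncomputable section

/-- Summing a centred weight against a function that is constant off the range of `k` only sees the
values on that range. -/
theorem sum_mul_eq_sum_range {α ι : Type*} [Fintype α] [DecidableEq α] [Fintype ι]
    {a : α → ℝ} (ha : ∑ i, a i = 0) (k : ι → α) (f : α → ℝ) (c : ℝ)
    (hf : ∀ x, x ∉ Finset.univ.image k → f x = c) :
    ∑ x, a x * f x =
      ∑ m, a (k m) * ((f (k m) - c) / (Finset.univ.filter fun m' => k m' = k m).card) := by
  have h1 : ∑ x, a x * f x = ∑ x, a x * (f x - c) := by
    simp [mul_sub, Finset.sum_sub_distrib, ← Finset.sum_mul, ha]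
  have h2 : ∑ x, a x * (f x - c) = ∑ x ∈ Finset.univ.image k, a x * (f x - c) := by
    symm
    apply Finset.sum_subset (Finset.subset_univ _)
    intro x _ hx
    simp [hf x hx]
  rw [h1, h2, Finset.sum_comp
    (fun x => a x * ((f x - c) / (Finset.univ.filter fun m' => k m' = x).card)) k]
  refine Finset.sum_congr rfl fun x hx => ?_
  have h3 : ((Finset.univ.filter fun m' => k m' = x).card : ℝ) ≠ 0 := by
    obtain ⟨m, -, hm⟩ := Finset.mem_image.1 hx
    exact_mod_cast (Finset.card_pos.2 ⟨m, by simpa using hm⟩).ne'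
  rw [nsmul_eq_mul]
  field_simp

theorem abs_sum_prod_pow_mul_le_of_two_le {α ι : Type*} [Fintype α] [Fintype ι] [DecidableEq ι]
    {a : α → ℝ} (ha : ∑ i, a i ^ 2 ≤ 1) {e : ι → ℕ} (he : ∀ l, 2 ≤ e l)
    {F : (ι → α) → ℝ} {M : ℝ} (hF : ∀ k, |F k| ≤ M) (hM : 0 ≤ M) :
    |∑ k, (∏ l, a (k l) ^ e l) * F k| ≤ M := by
  have habs : ∀ i, |a i| ≤ 1 := fun i => by
    rw [← sq_le_one_iff_abs_le_one]
    exact (Finset.single_le_sum (f := fun i => a i ^ 2) (fun i _ => sq_nonneg _)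
      (Finset.mem_univ i)).trans ha
  have hsum : ∀ l, ∑ i, |a i| ^ e l ≤ 1 := fun l => by
    refine le_trans (Finset.sum_le_sum fun i _ => ?_) ha
    rw [← sq_abs]
    exact pow_le_pow_of_le_one (abs_nonneg _) (habs i) (he l)
  calc |∑ k, (∏ l, a (k l) ^ e l) * F k|
      ≤ ∑ k, |(∏ l, a (k l) ^ e l) * F k| := Finset.abs_sum_le_sum_abs _ _
    _ ≤ ∑ k : ι → α, (∏ l, |a (k l)| ^ e l) * M := by
        refine Finset.sum_le_sum fun k _ => ?_
        rw [abs_mul, Finset.abs_prod]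
        simp only [abs_pow]
        exact mul_le_mul_of_nonneg_left (hF k) (by positivity)
    _ = (∏ l, ∑ i, |a i| ^ e l) * M := by
        rw [← Finset.sum_mul, Finset.prod_univ_sum, Fintype.piFinset_univ]
    _ ≤ 1 * M := by
        refine mul_le_mul_of_nonneg_right ?_ hM
        exact Finset.prod_le_one (fun l _ => by positivity) fun l _ => hsum l
    _ = M := one_mul M

open scoped Classical in
/-- The common value of `f` off the range of `k`, or `0` if `k` is surjective. -/
def offRange {α ι : Type*} (k : ι → α) (f : α → ℝ) : ℝ :=
  if h : ∃ x, x ∉ Set.range k then f h.choose else 0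

theorem offRange_eq {α ι : Type*} {k : ι → α} {f : α → ℝ}
    (hf : ∀ x y, x ∉ Set.range k → y ∉ Set.range k → f x = f y) {x : α} (hx : x ∉ Set.range k) :
    offRange k f = f x := by
  have h : ∃ x, x ∉ Set.range k := ⟨x, hx⟩
  rw [offRange, dif_pos h]
  exact hf _ _ h.choose_spec hx

theorem abs_offRange_le {α ι : Type*} {k : ι → α} {f : α → ℝ} {M : ℝ} (hM : 0 ≤ M)
    (hf : ∀ x, |f x| ≤ M) : |offRange k f| ≤ M := by
  rw [offRange]
  split_ifs
  · exact hf _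
  · simpa using hM

theorem perm_comp_insertNth {α : Type*} {n : ℕ} (σ : α → α) (l : Fin (n + 1)) (x : α)
    (k : Fin n → α) :
    σ ∘ (l.insertNth x k : Fin (n + 1) → α) = l.insertNth (σ x) (σ ∘ k) := by
  funext i
  refine Fin.succAboveCases l ?_ (fun j => ?_) i <;> simp

/-- A permutation-invariant multilinear form evaluated at a centred unit vector. -/
theorem abs_sum_prod_pow_mul_le {α : Type*} [Fintype α] [DecidableEq α] {a : α → ℝ}
    (ha0 : ∑ i, a i = 0) (ha : ∑ i, a i ^ 2 ≤ 1) (n : ℕ) :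
    ∀ (e : Fin n → ℕ) (_ : ∀ l, 1 ≤ e l) (F : (Fin n → α) → ℝ) (M : ℝ)
      (_ : ∀ k, |F k| ≤ M) (_ : 0 ≤ M) (_ : ∀ (σ : Equiv.Perm α) k, F (σ ∘ k) = F k),
      |∑ k, (∏ l, a (k l) ^ e l) * F k| ≤ 2 ^ n * n.factorial * M := by
  induction n with
  | zero =>
    intro e he F M hF hM _
    simpa using abs_sum_prod_pow_mul_le_of_two_le ha (e := e) (fun l => l.elim0) hF hM
  | succ n ih =>
    intro e he F M hF hM hinv
    by_cases h2 : ∀ l, 2 ≤ e l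
    · refine (abs_sum_prod_pow_mul_le_of_two_le ha h2 hF hM).trans ?_
      refine le_mul_of_one_le_left hM (one_le_mul_of_one_le_of_one_le ?_ ?_)
      · exact one_le_pow₀ one_le_two
      · exact_mod_cast Nat.factorial_pos _
    push Not at h2
    obtain ⟨l, hl⟩ := h2
    have hl1 : e l = 1 := by have := he l; omega
    let c : (Fin n → α) → ℝ := fun k => offRange k fun x => F (l.insertNth x k)
    have hconst : ∀ (k : Fin n → α) x y, x ∉ Set.range k → y ∉ Set.range k →
        F (l.insertNth x k) = F (l.insertNth y k) := by
      intro k x y hx hy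
      have := hinv (Equiv.swap x y) (l.insertNth x k)
      rw [perm_comp_insertNth, Equiv.swap_apply_left] at this
      rw [← this]
      congr 2
      funext m
      exact Equiv.swap_apply_of_ne_of_ne (fun h => hx ⟨m, h⟩) (fun h => hy ⟨m, h⟩)
    have hcinv : ∀ (σ : Equiv.Perm α) k, c (σ ∘ k) = c k := by
      intro σ k
      have hr : ∀ x, x ∉ Set.range k → σ x ∉ Set.range (σ ∘ k) := by
        rintro x hx ⟨m, hm⟩
        exact hx ⟨m, σ.injective hm⟩
      by_cases h : ∃ x, x ∉ Set.range k
      · obtain ⟨x, hx⟩ := h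
        simp only [c]
        rw [offRange_eq (hconst k) hx, offRange_eq (hconst (σ ∘ k)) (hr x hx),
          ← perm_comp_insertNth, hinv]
      · have h' : ¬ ∃ x, x ∉ Set.range (σ ∘ k) := by
          push Not at h ⊢
          intro x
          obtain ⟨m, hm⟩ := h (σ.symm x)
          exact ⟨m, by simp [hm]⟩
        simp only [c]
        rw [offRange, offRange, dif_neg h, dif_neg h']
    have hc : ∀ k, |c k| ≤ M := fun k => abs_offRange_le hM fun x => hF _
    let G : Fin n → (Fin n → α) → ℝ := fun m k =>
      (F (l.insertNth (k m) k) - c k) / (Finset.univ.filter fun m' => k m' = k m).card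
    have hG : ∀ m k, |G m k| ≤ 2 * M := by
      intro m k
      have h1 : (1 : ℝ) ≤ (Finset.univ.filter fun m' => k m' = k m).card := by
        exact_mod_cast Finset.card_pos.2 ⟨m, by simp⟩
      simp only [G]
      rw [abs_div, abs_of_nonneg (zero_le_one.trans h1)]
      refine (div_le_self (abs_nonneg _) h1).trans ((abs_sub _ _).trans ?_)
      linarith [hF (l.insertNth (k m) k), hc k]
    have hGinv : ∀ m (σ : Equiv.Perm α) k, G m (σ ∘ k) = G m k := by
      intro m σ k
      simp only [G]
      rw [hcinv, Function.comp_apply, ← perm_comp_insertNth, hinv]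
      simp
    have key : ∑ k, (∏ l, a (k l) ^ e l) * F k =
        ∑ m, ∑ k, (∏ l', a (k l') ^ (e (l.succAbove l') + if l' = m then 1 else 0)) * G m k := by
      rw [← (Fin.insertNthEquiv (fun _ => α) l).sum_comp, Fintype.sum_prod_type_right,
        Finset.sum_comm (s := Finset.univ (α := Fin n))]
      refine Finset.sum_congr rfl fun k _ => ?_
      have h1 := sum_mul_eq_sum_range ha0 k (fun x => F (l.insertNth x k)) (c k) (by
        intro x hx
        exact (offRange_eq (hconst k) (by simpa using hx)).symm)
      simp only [Fin.insertNthEquiv_apply, Fin.prod_univ_succAbove _ l, Fin.insertNth_apply_same,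
        Fin.insertNth_apply_succAbove, hl1, pow_one, pow_add, Finset.prod_mul_distrib]
      calc _ = (∏ m, a (k m) ^ e (l.succAbove m)) * ∑ x, a x * F (l.insertNth x k) := by
            rw [Finset.mul_sum]
            refine Finset.sum_congr rfl fun x _ => ?_
            change _ * F (l.insertNth x k) = _
            ring
        _ = _ := by
            rw [h1, Finset.mul_sum]
            refine Finset.sum_congr rfl fun m _ => ?_
            simp only [pow_ite, pow_one, pow_zero, Finset.prod_ite_eq', Finset.mem_univ, if_true, G]
            ring
    rw [key]
    calc _ ≤ ∑ m, |∑ k, (∏ l', a (k l') ^ (e (l.succAbove l') + if l' = m then 1 else 0)) *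
            G m k| := Finset.abs_sum_le_sum_abs _ _
      _ ≤ ∑ m : Fin n, 2 ^ n * n.factorial * (2 * M) := by
          refine Finset.sum_le_sum fun m _ => ?_
          exact ih _ (fun l' => (he _).trans (Nat.le_add_right _ _)) (G m) _ (hG m) (by positivity)
            (hGinv m)
      _ = 2 ^ (n + 1) * (n * n.factorial) * M := by simp; ring
      _ ≤ 2 ^ (n + 1) * (n + 1).factorial * M := by
          rw [Nat.factorial_succ]
          push_cast
          gcongr
          linarith

theorem abs_prod_le_sum_pow {ι : Type*} [Fintype ι] [Nonempty ι] (z : ι → ℝ) :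
    |∏ l, z l| ≤ ∑ l, |z l| ^ Fintype.card ι := by
  obtain ⟨m, hm⟩ := Finite.exists_max fun l => |z l|
  calc |∏ l, z l| = ∏ l, |z l| := Finset.abs_prod _ _
    _ ≤ ∏ _l : ι, |z m| := Finset.prod_le_prod (fun _ _ => abs_nonneg _) fun l _ => hm l
    _ = |z m| ^ Fintype.card ι := by simp
    _ ≤ _ := Finset.single_le_sum (f := fun l => |z l| ^ Fintype.card ι)
        (fun l _ => by positivity) (Finset.mem_univ m)

theorem quadratic_pow_eq_sum {α : Type*} [Fintype α] (a : α → ℝ) (z : α → α → ℝ) (q : ℕ) :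
    (∑ i, ∑ j, a i * a j * z i j) ^ q =
      ∑ k : Fin (q + q) → α,
        (∏ l, a (k l)) * ∏ l, z (k (Fin.castAdd q l)) (k (Fin.natAdd q l)) := by
  rw [← Fintype.sum_prod_type' (f := fun i j => a i * a j * z i j), Fintype.sum_pow,
    ← (Fin.appendEquiv q q).sum_comp,
    ← (Equiv.arrowProdEquivProdArrow (Fin q) (fun _ => α) fun _ => α).sum_comp]
  refine Finset.sum_congr rfl fun k _ => ?_
  simp [-Fin.natAdd_eq_addNat, Fin.prod_univ_add, Fin.appendEquiv, Finset.prod_mul_distrib]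

/-- The joint law of `Z` is invariant under simultaneous permutations of rows and columns. -/
def IsExchangeable {Ω α : Type*} [MeasurableSpace Ω] (μ : Measure Ω) (Z : α → α → Ω → ℝ) : Prop :=
  ∀ σ : Equiv.Perm α,
    Measure.map (fun ω => fun i j => Z (σ i) (σ j) ω) μ = Measure.map (fun ω => fun i j => Z i j ω) μ

namespace IsExchangeable

variable {Ω α : Type*} [MeasurableSpace Ω] {μ : Measure Ω} {Z : α → α → Ω → ℝ}

theorem comp (h : IsExchangeable μ Z) (hm : ∀ i j, Measurable (Z i j)) {g : ℝ → ℝ}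
    (hg : Measurable g) : IsExchangeable μ fun i j ω => g (Z i j ω) := by
  intro σ
  have hG : Measurable fun (y : α → α → ℝ) i j => g (y i j) := by fun_prop
  have := congrArg (Measure.map fun (y : α → α → ℝ) i j => g (y i j)) (h σ)
  rwa [Measure.map_map hG (by fun_prop), Measure.map_map hG (by fun_prop)] at this

theorem offDiag [DecidableEq α] (h : IsExchangeable μ Z) (hm : ∀ i j, Measurable (Z i j)) :
    IsExchangeable μ fun i j ω => if i = j then 0 else Z i j ω := by
  intro σ
  have hG : Measurable fun (y : α → α → ℝ) i j => if i = j then 0 else y i j := by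
    refine measurable_pi_lambda _ fun i => measurable_pi_lambda _ fun j => ?_
    split_ifs <;> fun_prop
  have := congrArg (Measure.map fun (y : α → α → ℝ) i j => if i = j then 0 else y i j) (h σ)
  rw [Measure.map_map hG (by fun_prop), Measure.map_map hG (by fun_prop)] at this
  simpa [Function.comp_def] using this

theorem integral_eq (h : IsExchangeable μ Z) (hm : ∀ i j, Measurable (Z i j))
    {g : (α → α → ℝ) → ℝ} (hg : Measurable g) (σ : Equiv.Perm α) :
    ∫ ω, g (fun i j => Z (σ i) (σ j) ω) ∂μ = ∫ ω, g (fun i j => Z i j ω) ∂μ := by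
  have hm' : ∀ σ : α → α, Measurable fun ω i j => Z (σ i) (σ j) ω := fun σ => by fun_prop
  have hmi : Measurable fun ω i j => Z i j ω := hm' id
  rw [← integral_map (hm' σ).aemeasurable hg.aestronglyMeasurable, h σ,
    integral_map hmi.aemeasurable hg.aestronglyMeasurable]

theorem identDistrib (h : IsExchangeable μ Z) (hm : ∀ i j, Measurable (Z i j))
    (σ : Equiv.Perm α) (i j : α) :
    ProbabilityTheory.IdentDistrib (Z (σ i) (σ j)) (Z i j) μ μ := by
  have : ProbabilityTheory.IdentDistrib (fun ω i j => Z (σ i) (σ j) ω) (fun ω i j => Z i j ω) μ μ :=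
    ⟨Measurable.aemeasurable (by fun_prop), Measurable.aemeasurable (by fun_prop), h σ⟩
  exact this.comp (u := fun y => y i j) (by fun_prop)

theorem identDistrib_of_ne [DecidableEq α] (h : IsExchangeable μ Z)
    (hm : ∀ i j, Measurable (Z i j)) {i j i' j' : α} (hij : i ≠ j) (hij' : i' ≠ j') :
    ProbabilityTheory.IdentDistrib (Z i j) (Z i' j') μ μ := by
  have hne : i ≠ Equiv.swap i' i j' := by
    intro hi
    exact hij' ((Equiv.swap i' i).injective ((Equiv.swap_apply_left i' i).trans hi))
  have := h.identDistrib hm (Equiv.swap (Equiv.swap i' i j') j * Equiv.swap i' i) i' j'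
  simpa [Equiv.swap_apply_of_ne_of_ne hne hij] using this

theorem identDistrib_diag [DecidableEq α] (h : IsExchangeable μ Z)
    (hm : ∀ i j, Measurable (Z i j)) (i i' : α) :
    ProbabilityTheory.IdentDistrib (Z i i) (Z i' i') μ μ := by
  simpa using h.identDistrib hm (Equiv.swap i' i) i' i'

theorem eLpNorm_diag_le [Fintype α] [DecidableEq α] (h : IsExchangeable μ Z)
    (hm : ∀ i j, Measurable (Z i j)) {b : α → ℝ} (hb0 : ∀ i, 0 ≤ b i) (hb : ∑ i, b i ≤ 1)
    (i₀ : α) {p : ENNReal} (hp : 1 ≤ p) :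
    eLpNorm (fun ω => ∑ i, b i * Z i i ω) p μ ≤ eLpNorm (Z i₀ i₀) p μ := by
  have hfun : (fun ω => ∑ i, b i * Z i i ω) = ∑ i, b i • Z i i := by
    ext ω
    simp
  rw [hfun]
  calc _ ≤ ∑ i, eLpNorm (b i • Z i i) p μ :=
        eLpNorm_sum_le (fun i _ => ((hm i i).const_smul _).aestronglyMeasurable) hp
    _ = ∑ i, ENNReal.ofReal (b i) * eLpNorm (Z i₀ i₀) p μ := by
        refine Finset.sum_congr rfl fun i _ => ?_
        rw [eLpNorm_const_smul, (h.identDistrib_diag hm i i₀).eLpNorm_eq,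
          Real.enorm_of_nonneg (hb0 i)]
    _ = ENNReal.ofReal (∑ i, b i) * eLpNorm (Z i₀ i₀) p μ := by
        rw [← Finset.sum_mul, ENNReal.ofReal_sum_of_nonneg fun i _ => hb0 i]
    _ ≤ 1 * eLpNorm (Z i₀ i₀) p μ := by
        gcongr
        exact ENNReal.ofReal_le_one.2 hb
    _ = _ := one_mul _

theorem lintegral_even_pow_le [IsProbabilityMeasure μ] [Fintype α] [DecidableEq α]
    (h : IsExchangeable μ Z) (hm : ∀ i j, Measurable (Z i j)) (hdiag : ∀ i ω, Z i i ω = 0)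
    {a : α → ℝ} (ha0 : ∑ i, a i = 0) (ha : ∑ i, a i ^ 2 ≤ 1) {i₀ j₀ : α} (hij : i₀ ≠ j₀)
    {q : ℕ} (hq : Even q) (hq0 : q ≠ 0) :
    ∫⁻ ω, ‖∑ i, ∑ j, a i * a j * Z i j ω‖ₑ ^ q ∂μ ≤
      ENNReal.ofReal ((32 * q ^ 2) ^ q) * ∫⁻ ω, ‖Z i₀ j₀ ω‖ₑ ^ q ∂μ := by
  have hqpos : 0 < q := Nat.pos_of_ne_zero hq0
  have henorm : ∀ x : ℝ, ‖x‖ₑ ^ q = ENNReal.ofReal (|x| ^ q) := fun x => by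
    rw [Real.enorm_eq_ofReal_abs, ENNReal.ofReal_pow (abs_nonneg x)]
  by_cases htop : ∫⁻ ω, ‖Z i₀ j₀ ω‖ₑ ^ q ∂μ = ⊤
  · rw [htop, ENNReal.mul_top]
    · exact le_top
    · rw [← pos_iff_ne_zero, ENNReal.ofReal_pos]
      positivity
  have hint₀ : Integrable (fun ω => |Z i₀ j₀ ω| ^ q) μ := by
    refine ⟨by fun_prop, ?_⟩
    rw [hasFiniteIntegral_iff_ofReal (.of_forall fun ω => by positivity)]
    simpa only [← henorm] using lt_top_iff_ne_top.2 htop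
  set M := ∫ ω, |Z i₀ j₀ ω| ^ q ∂μ with hM
  have hM0 : 0 ≤ M := integral_nonneg fun ω => by positivity
  have hZ : ∀ i j, Integrable (fun ω => |Z i j ω| ^ q) μ ∧ ∫ ω, |Z i j ω| ^ q ∂μ ≤ M := by
    intro i j
    by_cases hne : i = j
    · subst hne
      simp [hdiag, hq0, hM0]
    · have := (h.identDistrib_of_ne hm hne hij).comp (u := fun x => |x| ^ q) (by fun_prop)
      exact ⟨this.integrable_iff.2 hint₀, this.integral_eq.le⟩
  have : Nonempty (Fin q) := ⟨⟨0, hqpos⟩⟩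
  let P : (Fin (q + q) → α) → Ω → ℝ := fun k ω =>
    ∏ l, Z (k (Fin.castAdd q l)) (k (Fin.natAdd q l)) ω
  have hPm : ∀ k, Measurable (P k) := fun k => by fun_prop
  have hPle : ∀ k ω, |P k ω| ≤ ∑ l, |Z (k (Fin.castAdd q l)) (k (Fin.natAdd q l)) ω| ^ q :=
    fun k ω => by
      simpa [-Fin.natAdd_eq_addNat] using abs_prod_le_sum_pow fun l => Z (k (Fin.castAdd q l)) (k (Fin.natAdd q l)) ω
  have hsumint : ∀ k : Fin (q + q) → α, Integrable
      (fun ω => ∑ l, |Z (k (Fin.castAdd q l)) (k (Fin.natAdd q l)) ω| ^ q) μ := fun k =>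
    integrable_finsetSum _ fun l _ => (hZ _ _).1
  have hPint : ∀ k, Integrable (P k) μ := fun k =>
    (hsumint k).mono' (hPm k).aestronglyMeasurable (.of_forall (hPle k))
  have hPbound : ∀ k, |∫ ω, P k ω ∂μ| ≤ q * M := by
    intro k
    calc |∫ ω, P k ω ∂μ| ≤ ∫ ω, |P k ω| ∂μ := abs_integral_le_integral_abs
      _ ≤ ∫ ω, ∑ l, |Z (k (Fin.castAdd q l)) (k (Fin.natAdd q l)) ω| ^ q ∂μ :=
          integral_mono (hPint k).abs (hsumint k) (hPle k)
      _ = ∑ l, ∫ ω, |Z (k (Fin.castAdd q l)) (k (Fin.natAdd q l)) ω| ^ q ∂μ :=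
          integral_finsetSum _ fun l _ => (hZ _ _).1
      _ ≤ ∑ _l : Fin q, M := Finset.sum_le_sum fun l _ => (hZ _ _).2
      _ = q * M := by simp
  have hPinv : ∀ (σ : Equiv.Perm α) k, ∫ ω, P (σ ∘ k) ω ∂μ = ∫ ω, P k ω ∂μ := fun σ k =>
    h.integral_eq hm
      (g := fun y => ∏ l : Fin q, y (k (Fin.castAdd q l)) (k (Fin.natAdd q l))) (by fun_prop) σ
  have hexp : ∀ ω, |∑ i, ∑ j, a i * a j * Z i j ω| ^ q = ∑ k, (∏ l, a (k l)) * P k ω := fun ω => by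
    rw [hq.pow_abs, quadratic_pow_eq_sum]
  have hQint : Integrable (fun ω => |∑ i, ∑ j, a i * a j * Z i j ω| ^ q) μ := by
    simp only [hexp]
    exact integrable_finsetSum _ fun k _ => (hPint k).const_mul _
  have hQ : ∫ ω, |∑ i, ∑ j, a i * a j * Z i j ω| ^ q ∂μ ≤
      2 ^ (q + q) * (q + q).factorial * (q * M) := by
    simp only [hexp]
    rw [integral_finsetSum _ fun k _ => (hPint k).const_mul _]
    simp only [integral_const_mul]
    have := abs_sum_prod_pow_mul_le ha0 ha (q + q) (fun _ => 1) (fun _ => le_rfl)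
      (fun k => ∫ ω, P k ω ∂μ) (q * M) hPbound (by positivity) hPinv
    simp only [pow_one] at this
    exact (le_abs_self _).trans this
  have hconst : (2 : ℝ) ^ (q + q) * (q + q).factorial * q ≤ (32 * q ^ 2) ^ q := by
    have h1 : ((q + q).factorial : ℝ) ≤ (2 * q) ^ (q + q) := by
      rw [← two_mul]
      exact_mod_cast Nat.factorial_le_pow (2 * q)
    have h2 : (q : ℝ) ≤ 2 ^ q := by exact_mod_cast Nat.lt_two_pow_self.le
    calc (2 : ℝ) ^ (q + q) * (q + q).factorial * q ≤ 2 ^ (q + q) * (2 * q) ^ (q + q) * 2 ^ q := by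
          gcongr
      _ = (32 * q ^ 2) ^ q := by
          rw [pow_add, pow_add, ← mul_pow, ← mul_pow, ← mul_pow, ← mul_pow]
          ring
  simp only [henorm]
  rw [← ofReal_integral_eq_lintegral_ofReal hQint (.of_forall fun ω => by positivity),
    ← ofReal_integral_eq_lintegral_ofReal hint₀ (.of_forall fun ω => by positivity),
    ← ENNReal.ofReal_mul (by positivity)]
  refine ENNReal.ofReal_le_ofReal (hQ.trans ?_)
  rw [← mul_assoc]
  exact mul_le_mul_of_nonneg_right hconst hM0

end IsExchangeable

/-- `x ^ p` as a superposition of the functions `x ^ q * min t x ^ 2`, for `q < p < q + 2`. -/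
theorem lintegral_pow_mul_min_sq_mul_rpow {q : ℕ} {p x : ℝ} (hx : 0 ≤ x) (hqp : q < p)
    (hpq : p < q + 2) :
    ∫⁻ t in Set.Ioi (0 : ℝ), ENNReal.ofReal (x ^ q * min t x ^ 2 * t ^ (p - q - 3)) =
      ENNReal.ofReal ((1 / (p - q) + 1 / (q + 2 - p)) * x ^ p) := by
  rcases hx.eq_or_lt with rfl | hx
  · have hp : p ≠ 0 := (q.cast_nonneg.trans_lt hqp).ne'
    rw [setLIntegral_congr_fun (g := fun _ => 0) measurableSet_Ioi fun t ht => by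
      simp [min_eq_right (Set.mem_Ioi.1 ht).le]]
    simp [Real.zero_rpow hp]
  have hA : ∫⁻ t in Set.Ioc 0 x, ENNReal.ofReal (x ^ q * min t x ^ 2 * t ^ (p - q - 3)) =
      ENNReal.ofReal (1 / (p - q) * x ^ p) := by
    have hint : IntegrableOn (fun t : ℝ => x ^ q * t ^ (p - q - 1)) (Set.Ioc 0 x) :=
      ((intervalIntegrable_iff_integrableOn_Ioc_of_le hx.le).1
        (intervalIntegral.intervalIntegrable_rpow' (by linarith))).const_mul _
    rw [setLIntegral_congr_fun (g := fun t => ENNReal.ofReal (x ^ q * t ^ (p - q - 1)))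
      measurableSet_Ioc fun t ht => by
        simp only [min_eq_left ht.2]
        rw [mul_assoc, ← Real.rpow_natCast t 2, ← Real.rpow_add ht.1]
        congr 3
        push_cast
        ring]
    rw [← ofReal_integral_eq_lintegral_ofReal hint
      ((ae_restrict_mem measurableSet_Ioc).mono fun t ht => by
        have := ht.1
        positivity),
      integral_const_mul, ← intervalIntegral.integral_of_le hx.le,
      integral_rpow (Or.inl (by linarith))]
    congr 1
    have h1 : x ^ p = x ^ q * x ^ (p - q) := by
      rw [← Real.rpow_natCast x q, ← Real.rpow_add hx]
      congr 1
      ring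
    rw [h1, show p - q - 1 + 1 = p - q by ring, Real.zero_rpow (by linarith)]
    ring
  have hB : ∫⁻ t in Set.Ioi x, ENNReal.ofReal (x ^ q * min t x ^ 2 * t ^ (p - q - 3)) =
      ENNReal.ofReal (1 / (q + 2 - p) * x ^ p) := by
    have hint : IntegrableOn (fun t : ℝ => x ^ q * x ^ 2 * t ^ (p - q - 3)) (Set.Ioi x) :=
      (integrableOn_Ioi_rpow_of_lt (by linarith) hx).const_mul _
    rw [setLIntegral_congr_fun (g := fun t => ENNReal.ofReal (x ^ q * x ^ 2 * t ^ (p - q - 3)))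
      measurableSet_Ioi fun t ht => by simp only [min_eq_right (Set.mem_Ioi.1 ht).le]]
    rw [← ofReal_integral_eq_lintegral_ofReal hint
      ((ae_restrict_mem measurableSet_Ioi).mono fun t ht => by
        have := hx.trans ht
        positivity),
      integral_const_mul, integral_Ioi_rpow_of_lt (by linarith) hx]
    congr 1
    have h1 : x ^ p = x ^ q * x ^ 2 * x ^ (p - q - 3 + 1) := by
      rw [← pow_add, ← Real.rpow_natCast x, ← Real.rpow_add hx]
      congr 1
      push_cast
      ring
    have h2 : p - q - 3 + 1 ≠ 0 := by linarith
    have h3 : q + 2 - p ≠ 0 := by linarith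
    rw [h1]
    field_simp
    ring
  rw [← Set.Ioc_union_Ioi_eq_Ioi hx.le,
    lintegral_union measurableSet_Ioi (Set.Ioc_disjoint_Ioi le_rfl), hA, hB, add_mul,
    ENNReal.ofReal_add]
  · have := sub_pos.2 hqp
    positivity
  · have := sub_pos.2 hpq
    positivity

theorem abs_add_pow_mul_min_sq_le {x y t : ℝ} (ht : 0 ≤ t) (q : ℕ) :
    |x + y| ^ q * min t |x + y| ^ 2 ≤ 2 ^ (q + 2) * (t ^ 2 * |x| ^ q + |y| ^ (q + 2)) := by
  have hmin : 0 ≤ min t |x + y| := le_min ht (abs_nonneg _)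
  rcases le_total |y| |x| with h | h
  · have hxy : |x + y| ≤ 2 * |x| := (abs_add_le x y).trans (by linarith)
    calc |x + y| ^ q * min t |x + y| ^ 2 ≤ (2 * |x|) ^ q * t ^ 2 := by
          gcongr
          exact min_le_left _ _
      _ ≤ 2 ^ 2 * ((2 * |x|) ^ q * t ^ 2) := le_mul_of_one_le_left (by positivity) (by norm_num)
      _ = 2 ^ (q + 2) * (t ^ 2 * |x| ^ q) := by ring
      _ ≤ _ := by
          gcongr
          exact le_add_of_nonneg_right (by positivity)
  · have hxy : |x + y| ≤ 2 * |y| := (abs_add_le x y).trans (by linarith)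
    calc |x + y| ^ q * min t |x + y| ^ 2 ≤ (2 * |y|) ^ q * (2 * |y|) ^ 2 := by
          gcongr
          exact (min_le_right _ _).trans hxy
      _ = 2 ^ (q + 2) * |y| ^ (q + 2) := by ring
      _ ≤ _ := by
          gcongr
          exact le_add_of_nonneg_left (by positivity)

/-- Bounds at two levels of truncation interpolate to a bound on intermediate `L^p` norms. -/
theorem lintegral_rpow_le_of_lintegral_pow_mul_min_sq_le {Ω : Type*} [MeasurableSpace Ω]
    {μ : Measure Ω} [SFinite μ] {f g : Ω → ℝ} (hf : Measurable f) (hg : Measurable g) {q : ℕ}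
    {p : ℝ} (hqp : q < p) (hpq : p < q + 2) {C : ENNReal}
    (h : ∀ t > 0, ∫⁻ ω, ENNReal.ofReal (|g ω| ^ q * min t |g ω| ^ 2) ∂μ ≤
      C * ∫⁻ ω, ENNReal.ofReal (|f ω| ^ q * min t |f ω| ^ 2) ∂μ) :
    ∫⁻ ω, ‖g ω‖ₑ ^ p ∂μ ≤ C * ∫⁻ ω, ‖f ω‖ₑ ^ p ∂μ := by
  set c := ENNReal.ofReal (1 / (p - q) + 1 / (q + 2 - p)) with hc
  have hcpos : 0 < 1 / (p - q) + 1 / (q + 2 - p) := by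
    have := sub_pos.2 hqp
    have := sub_pos.2 hpq
    positivity
  have hp : 0 ≤ p := q.cast_nonneg.trans hqp.le
  have hrepr : ∀ u : Ω → ℝ, Measurable u → c * ∫⁻ ω, ‖u ω‖ₑ ^ p ∂μ =
      ∫⁻ t in Set.Ioi (0 : ℝ), ENNReal.ofReal (t ^ (p - q - 3)) *
        ∫⁻ ω, ENNReal.ofReal (|u ω| ^ q * min t |u ω| ^ 2) ∂μ := by
    intro u hu
    calc c * ∫⁻ ω, ‖u ω‖ₑ ^ p ∂μ = ∫⁻ ω, c * ‖u ω‖ₑ ^ p ∂μ :=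
          (lintegral_const_mul _ (by fun_prop)).symm
      _ = ∫⁻ ω, (∫⁻ t in Set.Ioi (0 : ℝ),
            ENNReal.ofReal (|u ω| ^ q * min t |u ω| ^ 2 * t ^ (p - q - 3))) ∂μ := by
          refine lintegral_congr fun ω => ?_
          rw [lintegral_pow_mul_min_sq_mul_rpow (abs_nonneg _) hqp hpq,
            ENNReal.ofReal_mul hcpos.le, Real.enorm_eq_ofReal_abs,
            ENNReal.ofReal_rpow_of_nonneg (abs_nonneg _) hp]
      _ = ∫⁻ t in Set.Ioi (0 : ℝ), ∫⁻ ω,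
            ENNReal.ofReal (|u ω| ^ q * min t |u ω| ^ 2 * t ^ (p - q - 3)) ∂μ :=
          lintegral_lintegral_swap (Measurable.aemeasurable (by fun_prop))
      _ = _ := by
          refine setLIntegral_congr_fun measurableSet_Ioi fun t ht => ?_
          rw [← lintegral_const_mul _ (by fun_prop)]
          refine lintegral_congr fun ω => ?_
          have := Real.rpow_nonneg (Set.mem_Ioi.1 ht).le (p - q - 3)
          rw [← ENNReal.ofReal_mul this, mul_comm]
  have hle : c * ∫⁻ ω, ‖g ω‖ₑ ^ p ∂μ ≤ c * (C * ∫⁻ ω, ‖f ω‖ₑ ^ p ∂μ) := by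
    rw [mul_left_comm, hrepr g hg, hrepr f hf, ← lintegral_const_mul _ (by fun_prop)]
    refine setLIntegral_mono (by fun_prop) fun t ht => ?_
    rw [mul_left_comm]
    gcongr
    exact h t ht
  exact (ENNReal.mul_le_mul_iff_right (ENNReal.ofReal_pos.2 hcpos).ne' ENNReal.ofReal_ne_top).1 hle

theorem abs_pow_mul_min_sq_eq {t z : ℝ} {q : ℕ} (hq : q ≠ 0) :
    |z| ^ q * min t |z| ^ 2 =
      t ^ 2 * |if t < |z| then z else 0| ^ q + |if t < |z| then 0 else z| ^ (q + 2) := by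
  split_ifs with h
  · rw [min_eq_left h.le]
    simp [mul_comm]
  · rw [min_eq_right (not_lt.1 h)]
    simp [hq, pow_add]

namespace IsExchangeable

variable {Ω α : Type*} [MeasurableSpace Ω] {μ : Measure Ω} [IsProbabilityMeasure μ]
  {Z : α → α → Ω → ℝ} [Fintype α] [DecidableEq α]

theorem lintegral_pow_mul_min_sq_le (h : IsExchangeable μ Z) (hm : ∀ i j, Measurable (Z i j))
    (hdiag : ∀ i ω, Z i i ω = 0) {a : α → ℝ} (ha0 : ∑ i, a i = 0) (ha : ∑ i, a i ^ 2 ≤ 1)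
    {i₀ j₀ : α} (hij : i₀ ≠ j₀) {q : ℕ} (hq : Even q) (hq0 : q ≠ 0) {t : ℝ} (ht : 0 ≤ t) :
    ∫⁻ ω, ENNReal.ofReal (|∑ i, ∑ j, a i * a j * Z i j ω| ^ q *
        min t |∑ i, ∑ j, a i * a j * Z i j ω| ^ 2) ∂μ ≤
      ENNReal.ofReal ((64 * (q + 2) ^ 2) ^ (q + 2)) *
        ∫⁻ ω, ENNReal.ofReal (|Z i₀ j₀ ω| ^ q * min t |Z i₀ j₀ ω| ^ 2) ∂μ := by
  have henorm : ∀ (n : ℕ) (x : ℝ), ENNReal.ofReal (|x| ^ n) = ‖x‖ₑ ^ n := fun n x => by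
    rw [Real.enorm_eq_ofReal_abs, ENNReal.ofReal_pow (abs_nonneg x)]
  let hi : ℝ → ℝ := fun z => if t < |z| then z else 0
  let lo : ℝ → ℝ := fun z => if t < |z| then 0 else z
  have hset : MeasurableSet {z : ℝ | t < |z|} := measurableSet_lt (by fun_prop) (by fun_prop)
  have hhi : Measurable hi := Measurable.ite hset measurable_id measurable_const
  have hlo : Measurable lo := Measurable.ite hset measurable_const measurable_id
  have hsplit : ∀ z, z = hi z + lo z := fun z => by
    simp only [hi, lo]
    split_ifs <;> simp
  let T : (ℝ → ℝ) → Ω → ℝ := fun g ω => ∑ i, ∑ j, a i * a j * g (Z i j ω)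
  have hTm : ∀ g, Measurable g → Measurable (T g) := fun g hg => by fun_prop
  have hQ : ∀ ω, ∑ i, ∑ j, a i * a j * Z i j ω = T hi ω + T lo ω := fun ω => by
    simp only [T, ← Finset.sum_add_distrib, ← mul_add, ← hsplit]
  set K : ℝ := 32 * (q + 2) ^ 2 with hK
  have hK1 : 1 ≤ K := by
    have : (0 : ℝ) ≤ q := q.cast_nonneg
    nlinarith
  have hThi : ∫⁻ ω, ‖T hi ω‖ₑ ^ q ∂μ ≤
      ENNReal.ofReal (K ^ (q + 2)) * ∫⁻ ω, ‖hi (Z i₀ j₀ ω)‖ₑ ^ q ∂μ := by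
    refine ((h.comp hm hhi).lintegral_even_pow_le (fun i j => hhi.comp (hm i j))
      (fun i ω => by simp [hdiag, hi]) ha0 ha hij hq hq0).trans ?_
    gcongr
    calc (32 * (q : ℝ) ^ 2) ^ q ≤ K ^ q := by
          gcongr
          rw [hK]
          gcongr
          linarith
      _ ≤ K ^ (q + 2) := pow_le_pow_right₀ hK1 (by omega)
  have hTlo : ∫⁻ ω, ‖T lo ω‖ₑ ^ (q + 2) ∂μ ≤
      ENNReal.ofReal (K ^ (q + 2)) * ∫⁻ ω, ‖lo (Z i₀ j₀ ω)‖ₑ ^ (q + 2) ∂μ := by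
    have := (h.comp hm hlo).lintegral_even_pow_le (fun i j => hlo.comp (hm i j))
      (fun i ω => by simp [hdiag, lo]) ha0 ha hij (hq.add even_two) (by omega)
    push_cast at this
    exact this
  have hcalc : ∀ u v : Ω → ℝ, Measurable u → Measurable v →
      ∫⁻ ω, ENNReal.ofReal (t ^ 2 * |u ω| ^ q + |v ω| ^ (q + 2)) ∂μ =
        ENNReal.ofReal (t ^ 2) * ∫⁻ ω, ‖u ω‖ₑ ^ q ∂μ + ∫⁻ ω, ‖v ω‖ₑ ^ (q + 2) ∂μ := by
    intro u v hu hv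
    rw [← lintegral_const_mul _ (by fun_prop), ← lintegral_add_left (by fun_prop)]
    refine lintegral_congr fun ω => ?_
    rw [ENNReal.ofReal_add (by positivity) (by positivity), ENNReal.ofReal_mul (by positivity),
      henorm, henorm]
  calc _ ≤ ∫⁻ ω, ENNReal.ofReal (2 ^ (q + 2)) *
          ENNReal.ofReal (t ^ 2 * |T hi ω| ^ q + |T lo ω| ^ (q + 2)) ∂μ := by
        refine lintegral_mono fun ω => ?_
        rw [hQ, ← ENNReal.ofReal_mul (by positivity)]
        exact ENNReal.ofReal_le_ofReal (abs_add_pow_mul_min_sq_le ht q)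
    _ = ENNReal.ofReal (2 ^ (q + 2)) * (ENNReal.ofReal (t ^ 2) * ∫⁻ ω, ‖T hi ω‖ₑ ^ q ∂μ +
          ∫⁻ ω, ‖T lo ω‖ₑ ^ (q + 2) ∂μ) := by
        have := hTm hi hhi
        have := hTm lo hlo
        rw [lintegral_const_mul _ (by fun_prop), hcalc _ _ (hTm hi hhi) (hTm lo hlo)]
    _ ≤ ENNReal.ofReal (2 ^ (q + 2)) * (ENNReal.ofReal (t ^ 2) *
          (ENNReal.ofReal (K ^ (q + 2)) * ∫⁻ ω, ‖hi (Z i₀ j₀ ω)‖ₑ ^ q ∂μ) +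
          ENNReal.ofReal (K ^ (q + 2)) * ∫⁻ ω, ‖lo (Z i₀ j₀ ω)‖ₑ ^ (q + 2) ∂μ) := by
        gcongr
    _ = ENNReal.ofReal ((64 * (q + 2) ^ 2) ^ (q + 2)) *
          (ENNReal.ofReal (t ^ 2) * ∫⁻ ω, ‖hi (Z i₀ j₀ ω)‖ₑ ^ q ∂μ +
            ∫⁻ ω, ‖lo (Z i₀ j₀ ω)‖ₑ ^ (q + 2) ∂μ) := by
        rw [show (64 * ((q : ℝ) + 2) ^ 2) = 2 * K by rw [hK]; ring, mul_pow 2 K,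
          ENNReal.ofReal_mul (by positivity), mul_assoc, mul_add (ENNReal.ofReal (K ^ (q + 2))),
          mul_left_comm (ENNReal.ofReal (t ^ 2))]
    _ = _ := by
        have := hcalc _ _ (hhi.comp (hm i₀ j₀)) (hlo.comp (hm i₀ j₀))
        simp only [Function.comp_apply] at this
        rw [← this]
        simp only [abs_pow_mul_min_sq_eq hq0, hi, lo]

theorem lintegral_rpow_le (h : IsExchangeable μ Z) (hm : ∀ i j, Measurable (Z i j))
    (hdiag : ∀ i ω, Z i i ω = 0) {a : α → ℝ} (ha0 : ∑ i, a i = 0) (ha : ∑ i, a i ^ 2 ≤ 1)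
    {i₀ j₀ : α} (hij : i₀ ≠ j₀) {p : ℝ} (hp : 2 ≤ p) :
    ∫⁻ ω, ‖∑ i, ∑ j, a i * a j * Z i j ω‖ₑ ^ p ∂μ ≤
      ENNReal.ofReal ((256 * p ^ 2) ^ (p + 2)) * ∫⁻ ω, ‖Z i₀ j₀ ω‖ₑ ^ p ∂μ := by
  obtain ⟨q, hq, hq0, hqp, hpq⟩ : ∃ q : ℕ, Even q ∧ q ≠ 0 ∧ (q : ℝ) ≤ p ∧ p < q + 2 := by
    have h1 : (1 : ℝ) ≤ p / 2 := by linarith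
    have h2 : 1 ≤ ⌊p / 2⌋₊ := Nat.le_floor (by simpa using h1)
    have h3 := Nat.floor_le (zero_le_one.trans h1)
    have h4 := Nat.lt_floor_add_one (p / 2)
    refine ⟨2 * ⌊p / 2⌋₊, even_two_mul _, by omega, ?_, ?_⟩ <;> push_cast <;> linarith
  have hB : (1 : ℝ) ≤ 256 * p ^ 2 := by nlinarith
  have hconst : (64 * ((q : ℝ) + 2) ^ 2) ^ (q + 2) ≤ (256 * p ^ 2) ^ (p + 2) := by
    calc (64 * ((q : ℝ) + 2) ^ 2) ^ (q + 2) ≤ (64 * (2 * p) ^ 2) ^ (q + 2) := by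
          gcongr
          linarith
      _ = (256 * p ^ 2) ^ ((q + 2 : ℕ) : ℝ) := by
          rw [Real.rpow_natCast]
          ring
      _ ≤ _ := by
          refine Real.rpow_le_rpow_of_exponent_le hB ?_
          push_cast
          linarith
  rcases hqp.eq_or_lt with rfl | hlt
  · simp only [ENNReal.rpow_natCast]
    refine (h.lintegral_even_pow_le hm hdiag ha0 ha hij hq hq0).trans ?_
    gcongr
    refine le_trans ?_ hconst
    have h0 : (0 : ℝ) ≤ q := q.cast_nonneg
    have h1 : 1 ≤ 64 * ((q : ℝ) + 2) ^ 2 := by nlinarith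
    calc (32 * (q : ℝ) ^ 2) ^ q ≤ (64 * ((q : ℝ) + 2) ^ 2) ^ q := by
          gcongr
          norm_num
      _ ≤ _ := pow_le_pow_right₀ h1 (by omega)
  · refine (lintegral_rpow_le_of_lintegral_pow_mul_min_sq_le (hm i₀ j₀) (by fun_prop) hlt hpq
      fun t ht => h.lintegral_pow_mul_min_sq_le hm hdiag ha0 ha hij hq hq0 ht.le).trans ?_
    gcongr

theorem eLpNorm_le (h : IsExchangeable μ Z) (hm : ∀ i j, Measurable (Z i j))
    (hdiag : ∀ i ω, Z i i ω = 0) {a : α → ℝ} (ha0 : ∑ i, a i = 0) (ha : ∑ i, a i ^ 2 ≤ 1)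
    {i₀ j₀ : α} (hij : i₀ ≠ j₀) {p : ℝ} (hp : 2 ≤ p) :
    eLpNorm (fun ω => ∑ i, ∑ j, a i * a j * Z i j ω) (ENNReal.ofReal p) μ ≤
      ENNReal.ofReal (2 ^ 20 * p ^ 2) * eLpNorm (Z i₀ j₀) (ENNReal.ofReal p) μ := by
  have hp0 : 0 < p := by linarith
  rw [eLpNorm_eq_lintegral_rpow_enorm_toReal (ENNReal.ofReal_pos.2 hp0).ne' ENNReal.ofReal_ne_top,
    eLpNorm_eq_lintegral_rpow_enorm_toReal (ENNReal.ofReal_pos.2 hp0).ne' ENNReal.ofReal_ne_top,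
    ENNReal.toReal_ofReal hp0.le]
  refine (ENNReal.rpow_le_rpow (h.lintegral_rpow_le hm hdiag ha0 ha hij hp)
    (by positivity)).trans ?_
  rw [ENNReal.mul_rpow_of_nonneg _ _ (by positivity),
    ENNReal.ofReal_rpow_of_nonneg (by positivity) (by positivity)]
  gcongr
  have hsmall : (256 * p ^ 2) ^ (2 / p) ≤ (2 : ℝ) ^ 12 := by
    have hle : p ≤ 2 ^ p := by
      have := one_add_mul_self_le_rpow_one_add (s := 1) (by norm_num) (p := p) (by linarith)
      norm_num at this
      linarith
    have h1 : p ^ (4 / p) ≤ (2 : ℝ) ^ 4 := by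
      calc p ^ (4 / p) ≤ ((2 : ℝ) ^ p) ^ (4 / p) := by gcongr
        _ = 2 ^ (4 : ℝ) := by
            rw [← Real.rpow_mul (by norm_num)]
            congr 1
            field_simp
        _ = 2 ^ 4 := by norm_num
    have h2 : (256 : ℝ) ^ (2 / p) ≤ 2 ^ 8 := by
      calc (256 : ℝ) ^ (2 / p) ≤ 256 ^ (1 : ℝ) :=
            Real.rpow_le_rpow_of_exponent_le (by norm_num) ((div_le_one hp0).2 hp)
        _ = 2 ^ 8 := by norm_num
    calc (256 * p ^ 2) ^ (2 / p) = 256 ^ (2 / p) * p ^ (4 / p) := by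
          rw [Real.mul_rpow (by norm_num) (by positivity), ← Real.rpow_natCast p 2,
            ← Real.rpow_mul hp0.le]
          congr 2
          push_cast
          ring
      _ ≤ 2 ^ 8 * 2 ^ 4 := by gcongr
      _ = 2 ^ 12 := by norm_num
  calc ((256 * p ^ 2) ^ (p + 2)) ^ (1 / p) = (256 * p ^ 2) * (256 * p ^ 2) ^ (2 / p) := by
        rw [← Real.rpow_mul (by positivity), ← Real.rpow_one_add' (by positivity) (by positivity)]
        congr 1
        field_simp
    _ ≤ (256 * p ^ 2) * 2 ^ 12 := by gcongr
    _ = 2 ^ 20 * p ^ 2 := by ring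

end IsExchangeable

/-- **L^p bound for centred quadratic forms of exchangeable random matrices.**
If `(Y_{ij})` is exchangeable and `Σ a_i = 0`, `Σ a_i² ≤ 1`, then
`‖Σ_{i,j} a_i a_j Y_{ij}‖_p ≤ ‖Y_{11}‖_p + C (p²/log p)² ‖Y_{12}‖_p`. -/
theorem exchangeable_quadratic_form_Lp :
    ∃ C : ℝ, 0 < C ∧
      ∀ (N : ℕ) (hN : 2 ≤ N) (Ω : Type) [MeasurableSpace Ω] (μ : Measure Ω)
        [IsProbabilityMeasure μ] (Y : Fin N → Fin N → Ω → ℝ),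
        (∀ i j, Measurable (Y i j)) →
        (∀ σ : Equiv.Perm (Fin N),
          Measure.map (fun ω => fun i j => Y (σ i) (σ j) ω) μ =
            Measure.map (fun ω => fun i j => Y i j ω) μ) →
        ∀ a : Fin N → ℝ, (∑ i, a i) = 0 → (∑ i, a i ^ 2) ≤ 1 →
          ∀ p : ℝ, 2 ≤ p →
            eLpNorm (fun ω => ∑ i, ∑ j, a i * a j * Y i j ω) (ENNReal.ofReal p) μ ≤
              eLpNorm (Y ⟨0, by omega⟩ ⟨0, by omega⟩) (ENNReal.ofReal p) μ +
                ENNReal.ofReal (C * (p ^ 2 / Real.log p) ^ 2) *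
                  eLpNorm (Y ⟨0, by omega⟩ ⟨1, by omega⟩) (ENNReal.ofReal p) μ := by
  refine ⟨2 ^ 20, by norm_num, ?_⟩
  intro N hN Ω _ μ _ Y hm hex a ha0 ha p hp
  have h : IsExchangeable μ Y := hex
  let Z : Fin N → Fin N → Ω → ℝ := fun i j ω => if i = j then 0 else Y i j ω
  have hZm : ∀ i j, Measurable (Z i j) := fun i j => by
    simp only [Z]
    split_ifs <;> fun_prop
  have hne : (⟨0, by omega⟩ : Fin N) ≠ ⟨1, by omega⟩ := by simp
  have hsplit : (fun ω => ∑ i, ∑ j, a i * a j * Y i j ω) =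
      (fun ω => ∑ i, a i ^ 2 * Y i i ω) + fun ω => ∑ i, ∑ j, a i * a j * Z i j ω := by
    ext ω
    rw [Pi.add_apply, ← Finset.sum_add_distrib]
    refine Finset.sum_congr rfl fun i _ => ?_
    rw [← Finset.add_sum_erase _ _ (Finset.mem_univ i),
      ← Finset.add_sum_erase _ (fun j => a i * a j * Z i j ω) (Finset.mem_univ i)]
    have : ∀ j ∈ Finset.univ.erase i, a i * a j * Z i j ω = a i * a j * Y i j ω := fun j hj => by
      simp [Z, (Finset.ne_of_mem_erase hj).symm]
    rw [Finset.sum_congr rfl this]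
    simp only [Z, if_true]
    ring
  have hp1 : 1 ≤ ENNReal.ofReal p := ENNReal.one_le_ofReal.2 (by linarith)
  have hoff := (h.offDiag hm).eLpNorm_le hZm (fun i ω => by simp) ha0 ha hne hp
  have hZ01 : (fun ω => if (⟨0, by omega⟩ : Fin N) = ⟨1, by omega⟩ then (0 : ℝ) else
      Y ⟨0, by omega⟩ ⟨1, by omega⟩ ω) = Y ⟨0, by omega⟩ ⟨1, by omega⟩ := by
    simp
  rw [hZ01] at hoff
  rw [hsplit]
  refine (eLpNorm_add_le (Measurable.aestronglyMeasurable (by fun_prop))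
    (Measurable.aestronglyMeasurable (by fun_prop)) hp1).trans (add_le_add
    (h.eLpNorm_diag_le hm (fun i => sq_nonneg (a i)) ha _ hp1) (hoff.trans ?_))
  gcongr
  have hlog : 0 < Real.log p := Real.log_pos (by linarith)
  rw [le_div_iff₀ hlog, sq]
  gcongr
  exact Real.log_le_self (by linarith)

end
end
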